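/- Let m : [0,1] → ℝ² be a map with values in the square [0,1]² whose total variation V := sup over all partitions 0 ≤ t₀ < t₁ < ⋯ < t_k ≤ 1 of Σᵢ |m(t_{i+1}) − m(t_i)| is finite. Then the image m([0,1]) is not dense in [0,1]²; more precisely, there exists a closed square Q ⊆ [0,1]² of side length 1/(5(V+1)) such that Q ∩ m([0,1]) = ∅. -/

import Mathlib

open MeasureTheory Filter ENNReal

noncomputable section

lemma bvaux_sep (m : ℝ → EuclideanSpace ℝ (Fin 2)) (s : Set ℝ)
    (hBV : eVariationOn m s ≠ ⊤) (T : Finset ℝ) (n : ℕ) (hT : T.card = n + 1)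
    (hTs : ∀ t ∈ T, t ∈ s) (δ : ℝ)
    (hd : ∀ x ∈ T, ∀ y ∈ T, x ≠ y → δ ≤ dist (m x) (m y)) :
    (n : ℝ) * δ ≤ (eVariationOn m s).toReal := by
  let u : ℕ → ℝ := fun i => T.orderEmbOfFin hT ⟨min i n, by omega⟩
  have hu : Monotone u := by
    intro i j hij
    apply (T.orderEmbOfFin hT).monotone
    simp only [Fin.mk_le_mk]
    omega
  have huT : ∀ i, u i ∈ T := fun i => T.orderEmbOfFin_mem hT _
  have h1 := eVariationOn.sum_le (f := m) (s := s) (n := n) hu (fun i => hTs _ (huT i))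
  have h2 : ∑ i ∈ Finset.range n, ENNReal.ofReal δ ≤ eVariationOn m s := by
    refine le_trans (Finset.sum_le_sum ?_) h1
    intro i hi
    rw [Finset.mem_range] at hi
    rw [edist_dist]
    apply ENNReal.ofReal_le_ofReal
    apply hd _ (huT _) _ (huT _)
    intro h
    have := (T.orderEmbOfFin hT).injective h
    simp only [Fin.mk.injEq] at this
    omega
  rw [Finset.sum_const, Finset.card_range, nsmul_eq_mul] at h2
  have h3 := ENNReal.toReal_mono hBV h2
  rw [ENNReal.toReal_mul, ENNReal.toReal_natCast] at h3
  refine le_trans ?_ h3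
  gcongr
  rw [ENNReal.toReal_ofReal']
  exact le_max_left _ _

lemma bvaux_coord (l d x y : ℝ) (hl : 0 < l) (hd : 0 < d) (i j : ℕ) (hij : i ≠ j)
    (hx : x ∈ Set.Icc (i * (l + d)) (i * (l + d) + l))
    (hy : y ∈ Set.Icc (j * (l + d)) (j * (l + d) + l)) : d ≤ |x - y| := by
  obtain ⟨hx1, hx2⟩ := hx
  obtain ⟨hy1, hy2⟩ := hy
  rcases lt_or_gt_of_ne hij with h | h
  · have : (i : ℝ) + 1 ≤ j := by exact_mod_cast h
    rw [abs_sub_comm]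
    refine le_trans ?_ (le_abs_self _)
    nlinarith
  · have : (j : ℝ) + 1 ≤ i := by exact_mod_cast h
    refine le_trans ?_ (le_abs_self _)
    nlinarith

lemma bvaux_dist (x y : EuclideanSpace ℝ (Fin 2)) (i : Fin 2) : |x i - y i| ≤ dist x y := by
  rw [dist_eq_norm]
  have := PiLp.norm_apply_le (x - y) i
  simpa using this


/-- the image of a curve of bounded variation with values in the unit
    square [0,1]² is not dense in [0,1]²: it misses a closed square of side length
    1/(5(V+1)), where V is the total variation of the curve. -/
theorem bv_curve_not_dense (m : ℝ → EuclideanSpace ℝ (Fin 2))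
    (hrange : ∀ t ∈ Set.Icc (0:ℝ) 1, m t 0 ∈ Set.Icc (0:ℝ) 1 ∧ m t 1 ∈ Set.Icc (0:ℝ) 1)
    (hBV : eVariationOn m (Set.Icc 0 1) ≠ ⊤) :
    ∃ a b : ℝ,
      Set.Icc a (a + 1 / (5 * ((eVariationOn m (Set.Icc 0 1)).toReal + 1)))
        ⊆ Set.Icc (0:ℝ) 1 ∧
      Set.Icc b (b + 1 / (5 * ((eVariationOn m (Set.Icc 0 1)).toReal + 1)))
        ⊆ Set.Icc (0:ℝ) 1 ∧
      ∀ t ∈ Set.Icc (0:ℝ) 1,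
        ¬ (m t 0 ∈ Set.Icc a (a + 1 / (5 * ((eVariationOn m (Set.Icc 0 1)).toReal + 1))) ∧
           m t 1 ∈ Set.Icc b (b + 1 / (5 * ((eVariationOn m (Set.Icc 0 1)).toReal + 1)))) := by
  set V := (eVariationOn m (Set.Icc 0 1)).toReal with hV
  have hV0 : 0 ≤ V := ENNReal.toReal_nonneg
  clear_value V
  set l := 1 / (5 * (V + 1)) with hl
  have hl0 : 0 < l := by positivity
  have hlV : l * (5 * (V + 1)) = 1 := by rw [hl]; field_simp
  clear_value l
  obtain ⟨k, hk1, hk2⟩ : ∃ k : ℕ, (5 * V + 4) / 2 ≤ k ∧ (k : ℝ) < (5 * V + 4) / 2 + 1 :=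
    ⟨_, Nat.le_ceil _, Nat.ceil_lt_add_one (by positivity)⟩
  have hk : (2 : ℝ) ≤ k := by linarith
  have hkl : k * l < 1 := by nlinarith
  obtain ⟨d, hd⟩ : ∃ d : ℝ, d * (k - 1) = 1 - k * l :=
    ⟨(1 - k * l) / (k - 1), div_mul_cancel₀ _ (by linarith)⟩
  have hd0 : 0 < d := by
    by_contra h
    nlinarith
  by_contra hcon
  push Not at hcon
  have hsub : ∀ i : Fin k, Set.Icc ((i : ℕ) * (l + d)) ((i : ℕ) * (l + d) + l)
      ⊆ Set.Icc (0 : ℝ) 1 := by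
    intro i
    have hi : ((i : ℕ) : ℝ) + 1 ≤ k := by exact_mod_cast i.2
    apply Set.Icc_subset_Icc
    · positivity
    · nlinarith
  have hex : ∀ p : Fin k × Fin k, ∃ t ∈ Set.Icc (0 : ℝ) 1,
      m t 0 ∈ Set.Icc ((p.1 : ℕ) * (l + d)) ((p.1 : ℕ) * (l + d) + l) ∧
      m t 1 ∈ Set.Icc ((p.2 : ℕ) * (l + d)) ((p.2 : ℕ) * (l + d) + l) :=
    fun p => hcon _ _ (hsub p.1) (hsub p.2)
  choose f hf hf0 hf1 using hex
  have hdist : ∀ p q, p ≠ q → d ≤ dist (m (f p)) (m (f q)) := by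
    intro p q hpq
    by_cases h : p.1 = q.1
    · have h2 : (p.2 : ℕ) ≠ q.2 := fun h' => hpq (Prod.ext h (Fin.ext h'))
      exact (bvaux_coord l d _ _ hl0 hd0 _ _ h2 (hf1 p) (hf1 q)).trans (bvaux_dist _ _ 1)
    · have h2 : (p.1 : ℕ) ≠ q.1 := fun h' => h (Fin.ext h')
      exact (bvaux_coord l d _ _ hl0 hd0 _ _ h2 (hf0 p) (hf0 q)).trans (bvaux_dist _ _ 0)
  have hinj : Function.Injective f := by
    intro p q h
    by_contra hpq
    have := hdist p q hpq
    rw [h, dist_self] at this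
    linarith
  have hk' : 2 ≤ k := by exact_mod_cast hk
  have hkk : 1 ≤ k * k := by nlinarith
  have hcard : (Finset.univ.image f).card = (k * k - 1) + 1 := by
    rw [Finset.card_image_of_injective _ hinj]
    simp
    omega
  have key := bvaux_sep m (Set.Icc 0 1) hBV (Finset.univ.image f) (k * k - 1) hcard
    (by
      intro t ht
      obtain ⟨p, -, rfl⟩ := Finset.mem_image.1 ht
      exact hf p) d
    (by
      intro x hx y hy hxy
      obtain ⟨p, -, rfl⟩ := Finset.mem_image.1 hx
      obtain ⟨q, -, rfl⟩ := Finset.mem_image.1 hy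
      exact hdist p q (fun h => hxy (by rw [h])))
  rw [← hV, Nat.cast_sub hkk] at key
  push_cast at key
  have e1 : ((k : ℝ) * k - 1) * d = (k + 1) * (1 - k * l) := by rw [← hd]; ring
  rw [e1] at key
  have e2 : ((k : ℝ) + 1) * (5 * (V + 1) - k) ≤ V * (5 * (V + 1)) := by
    have := mul_le_mul_of_nonneg_right key (by positivity : 0 ≤ 5 * (V + 1))
    calc ((k : ℝ) + 1) * (5 * (V + 1) - k)
        = ((k : ℝ) + 1) * (5 * (V + 1) - k * (l * (5 * (V + 1)))) := by rw [hlV, mul_one]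
      _ = ((k : ℝ) + 1) * (1 - k * l) * (5 * (V + 1)) := by ring
      _ ≤ _ := this
  nlinarith [mul_nonneg (sub_nonneg.2 hk1) (sub_nonneg.2 hk2.le)]
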